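/- Let q = p_1^a · p_2^b with p_1 and p_2 distinct primes and a, b positive integers, and let n be a positive integer. For a vector x ∈ (ℤ/qℤ)^n, one has ∑_{i=1}^n exp(2πi·x_i/q) = 0 if and only if there exist nonnegative integers s and t with p_1·s + p_2·t = n such that the multiset of coordinates of x is a disjoint union (multiset sum) of s multisets of the form {r, r + q/p_1, r + 2q/p_1, …, r + (p_1−1)q/p_1} (r ∈ ℤ/qℤ) and t multisets of the form {R, R + q/p_2, R + 2q/p_2, …, R + (p_2−1)q/p_2} (R ∈ ℤ/qℤ). -/

import Mathlib

open Complex Finset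

/-- The evaluation of a vector `x ∈ (ℤ/qℤ)^n` as a sum of complex `q`-th roots of unity. -/
noncomputable def rootSumEval (n q : ℕ) (x : Fin n → ZMod q) : ℂ :=
  ∑ i, Complex.exp (2 * Real.pi * Complex.I * ((x i).val : ℂ) / q)

/-- The coset `{r, r + q/p, r + 2q/p, …, r + (p-1)q/p}` in `ℤ/qℤ`, as a multiset. -/
def rotatedCoset (q p : ℕ) (r : ZMod q) : Multiset (ZMod q) :=
  (Multiset.range p).map (fun k => r + ((k * (q / p) : ℕ) : ZMod q))

open ZMod in
lemma isPrimitiveRoot_stdAddChar_one (q : ℕ) [NeZero q] :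
    IsPrimitiveRoot (stdAddChar (1 : ZMod q)) q := by
  have h := stdAddChar_coe (N := q) 1
  rw [Int.cast_one, Int.cast_one, mul_one] at h
  exact h ▸ Complex.isPrimitiveRoot_exp q (NeZero.ne q)

open ZMod Polynomial in
/-- If the evaluation of `M` at one primitive `q`-th root of unity vanishes, then so does the
evaluation at each of its Galois conjugates. -/
lemma sum_map_stdAddChar_pow_eq_zero {q : ℕ} [NeZero q] {M : Multiset (ZMod q)}
    (hM : (M.map fun j => stdAddChar (N := q) j).sum = 0) {m : ℕ} (hm : m.Coprime q) :
    (M.map fun j => stdAddChar (N := q) j ^ m).sum = 0 := by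
  have hζ := isPrimitiveRoot_stdAddChar_one q
  have hpow (j : ZMod q) : stdAddChar j = stdAddChar (1 : ZMod q) ^ j.val := by
    rw [← AddChar.map_nsmul_eq_pow]; simp
  have haeval (ξ : ℂ) : aeval ξ (M.map fun j : ZMod q => (X : ℚ[X]) ^ j.val).sum
      = (M.map fun j => ξ ^ j.val).sum := by
    rw [map_multiset_sum, Multiset.map_map]; simp
  have hroot : aeval (stdAddChar (1 : ZMod q)) (M.map fun j : ZMod q => (X : ℚ[X]) ^ j.val).sum
      = 0 := by
    rw [haeval, ← hM]
    exact congrArg _ (Multiset.map_congr rfl fun j _ => (hpow j).symm)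
  have hdvd := minpoly.dvd ℚ _ hroot
  rw [← cyclotomic_eq_minpoly_rat hζ (NeZero.pos q),
    cyclotomic_eq_minpoly_rat (hζ.pow_of_coprime m hm) (NeZero.pos q)] at hdvd
  obtain ⟨g, hg⟩ := hdvd
  have := haeval (stdAddChar (1 : ZMod q) ^ m)
  rw [hg, map_mul, minpoly.aeval, zero_mul] at this
  rw [this]
  refine congrArg _ (Multiset.map_congr rfl fun j _ => ?_)
  rw [hpow j, pow_right_comm]

open ZMod in
lemma dft_comp_add_right {q : ℕ} [NeZero q] (f : ZMod q → ℂ) (h k : ZMod q) :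
    dft (fun x => f (x + h)) k = stdAddChar (h * k) * dft f k := by
  simp only [dft_apply, smul_eq_mul, Finset.mul_sum]
  refine Fintype.sum_equiv (Equiv.addRight h) _ _ fun x => ?_
  rw [← mul_assoc, ← AddChar.map_add_eq_mul, Equiv.coe_addRight]
  congr 2
  ring

open ZMod in
lemma dft_count {q : ℕ} [NeZero q] (M : Multiset (ZMod q)) (k : ZMod q) :
    dft (fun x => (M.count x : ℂ)) k = (M.map fun j => stdAddChar (-(j * k))).sum := by
  rw [Finset.sum_multiset_map_count, dft_apply]
  trans ∑ x ∈ M.toFinset, stdAddChar (-(x * k)) • (M.count x : ℂ)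
  · refine (Finset.sum_subset (Finset.subset_univ _) fun x _ hx => ?_).symm
    simp [Multiset.count_eq_zero.2 (by simpa using hx)]
  · exact Finset.sum_congr rfl fun x _ => by simp [mul_comm]

open ZMod in
/-- A vanishing sum of roots of unity has vanishing mixed differences along the two subgroups of
prime order. -/
lemma count_mixed_difference {p₁ p₂ q : ℕ} [NeZero q] (h₁ : p₁ ∣ q) (h₂ : p₂ ∣ q)
    (hpr : ∀ p : ℕ, p.Prime → p ∣ q → p = p₁ ∨ p = p₂) {M : Multiset (ZMod q)}
    (hM : (M.map fun j => stdAddChar (N := q) j).sum = 0) (i j : ℕ) (x : ZMod q) :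
    M.count x + M.count (x + (i * (q / p₁) : ℕ) + (j * (q / p₂) : ℕ)) =
      M.count (x + (i * (q / p₁) : ℕ)) + M.count (x + (j * (q / p₂) : ℕ)) := by
  set a : ZMod q := ((i * (q / p₁) : ℕ) : ZMod q)
  set b : ZMod q := ((j * (q / p₂) : ℕ) : ZMod q)
  set f : ZMod q → ℂ := fun x => (M.count x : ℂ) with hf
  have hmul (p : ℕ) (hp : p ∣ q) (i : ℕ) (k : ZMod q) (hk : p ∣ k.val) :
      ((i * (q / p) : ℕ) : ZMod q) * k = 0 := by
    obtain ⟨c, hc⟩ := hk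
    rw [← ZMod.natCast_zmod_val k, hc, ← Nat.cast_mul, ZMod.natCast_eq_zero_iff]
    refine ⟨i * c, ?_⟩
    calc i * (q / p) * (p * c) = (q / p * p) * (i * c) := by ring
      _ = _ := by rw [Nat.div_mul_cancel hp]
  have hzero : (fun x => f x) - (fun x => f (x + a)) - (fun x => f (x + b))
      + (fun x => f (x + (a + b))) = 0 := by
    apply dft.injective
    ext k
    simp only [map_add, map_sub, map_zero, Pi.add_apply, Pi.sub_apply, Pi.zero_apply,
      dft_comp_add_right]
    rw [add_mul, AddChar.map_add_eq_mul]
    have hcases : a * k = 0 ∨ b * k = 0 ∨ dft f k = 0 := by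
      by_cases hk : k.val.Coprime q
      · right; right
        obtain ⟨m, hm, hmk⟩ : ∃ m : ℕ, m.Coprime q ∧ (m : ZMod q) = -k := by
          refine ⟨(-k).val, ?_, by simp⟩
          have := (ZMod.isUnit_iff_coprime k.val q).2 hk
          rw [← ZMod.isUnit_iff_coprime]
          simpa using this
        rw [hf, dft_count, ← sum_map_stdAddChar_pow_eq_zero hM hm]
        refine congrArg _ (Multiset.map_congr rfl fun y _ => ?_)
        rw [← AddChar.map_nsmul_eq_pow, nsmul_eq_mul, hmk]
        congr 1
        ring
      · obtain ⟨p, hp, hpk, hpq⟩ := Nat.Prime.not_coprime_iff_dvd.1 hk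
        rcases hpr p hp hpq with rfl | rfl
        · exact Or.inl (hmul _ h₁ _ _ hpk)
        · exact Or.inr (Or.inl (hmul _ h₂ _ _ hpk))
    rcases hcases with h | h | h <;> simp [h]
  have := congrFun hzero x
  simp only [Pi.add_apply, Pi.sub_apply, Pi.zero_apply, ← add_assoc, hf] at this
  have h' : (M.count x : ℂ) + M.count (x + a + b) = M.count (x + a) + M.count (x + b) := by
    linear_combination this
  exact_mod_cast h'

lemma nodup_rotatedCoset {p q : ℕ} [NeZero q] (hp : p ∣ q) (r : ZMod q) :
    (rotatedCoset q p r).Nodup := by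
  have hq := NeZero.pos q
  have hd : 0 < q / p := Nat.div_pos (Nat.le_of_dvd hq hp) (Nat.pos_of_dvd_of_pos hp hq)
  refine Multiset.Nodup.map_on (fun k hk l hl h => ?_) (Multiset.nodup_range p)
  have hlt (k : ℕ) (hk : k ∈ Multiset.range p) : k * (q / p) < q := by
    calc k * (q / p) < p * (q / p) := Nat.mul_lt_mul_of_pos_right (Multiset.mem_range.1 hk) hd
      _ = q := Nat.mul_div_cancel' hp
  have h' := (ZMod.natCast_eq_natCast_iff' _ _ _).1 (add_left_cancel h)
  rw [Nat.mod_eq_of_lt (hlt k hk), Nat.mod_eq_of_lt (hlt l hl)] at h'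
  exact Nat.eq_of_mul_eq_mul_right hd h'

open ZMod in
lemma sum_map_stdAddChar_rotatedCoset {p q : ℕ} [NeZero q] (hp : p ∣ q) (hp1 : 1 < p)
    (r : ZMod q) : ((rotatedCoset q p r).map fun j => stdAddChar (N := q) j).sum = 0 := by
  have hζ := isPrimitiveRoot_stdAddChar_one q
  have hω := hζ.pow (NeZero.pos q) (Nat.div_mul_cancel hp).symm
  have hterm (k : ℕ) : stdAddChar (r + ((k * (q / p) : ℕ) : ZMod q))
      = stdAddChar r * (stdAddChar (1 : ZMod q) ^ (q / p)) ^ k := by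
    rw [AddChar.map_add_eq_mul, ← pow_mul, ← AddChar.map_nsmul_eq_pow, nsmul_one, mul_comm k]
  rw [rotatedCoset, Multiset.map_map]
  simp only [Function.comp_def, hterm]
  rw [Multiset.sum_map_mul_left]
  exact mul_eq_zero_of_right _ (hω.geom_sum_eq_zero hp1)

open ZMod in
/-- A nonempty vanishing sum contains a coset of one of the two subgroups of prime order. -/
lemma exists_rotatedCoset_le {p₁ p₂ q : ℕ} [NeZero q] (h₁ : p₁ ∣ q) (h₂ : p₂ ∣ q)
    (hpr : ∀ p : ℕ, p.Prime → p ∣ q → p = p₁ ∨ p = p₂) {M : Multiset (ZMod q)}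
    (hM : (M.map fun j => stdAddChar (N := q) j).sum = 0) {x : ZMod q} (hx : x ∈ M) :
    rotatedCoset q p₁ x ≤ M ∨ rotatedCoset q p₂ x ≤ M := by
  rw [Multiset.le_iff_subset (nodup_rotatedCoset h₁ x),
    Multiset.le_iff_subset (nodup_rotatedCoset h₂ x)]
  by_contra! h
  simp only [rotatedCoset, Multiset.subset_iff, Multiset.mem_map] at h
  push Not at h
  obtain ⟨⟨_, ⟨i, -, rfl⟩, hi⟩, ⟨_, ⟨j, -, rfl⟩, hj⟩⟩ := h
  have := count_mixed_difference h₁ h₂ hpr hM i j x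
  rw [Multiset.count_eq_zero.2 hi, Multiset.count_eq_zero.2 hj] at this
  have := Multiset.count_pos.2 hx
  omega

open ZMod in
lemma sum_map_stdAddChar_eq_zero_iff {p₁ p₂ q : ℕ} [NeZero q] (h₁ : p₁ ∣ q) (h₂ : p₂ ∣ q)
    (hp₁ : 1 < p₁) (hp₂ : 1 < p₂) (hpr : ∀ p : ℕ, p.Prime → p ∣ q → p = p₁ ∨ p = p₂)
    (M : Multiset (ZMod q)) :
    (M.map fun j => stdAddChar (N := q) j).sum = 0 ↔ ∃ rs Rs : Multiset (ZMod q),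
      M = rs.bind (rotatedCoset q p₁) + Rs.bind (rotatedCoset q p₂) := by
  have hbind {p : ℕ} (hp : p ∣ q) (hp1 : 1 < p) (s : Multiset (ZMod q)) :
      ((s.bind (rotatedCoset q p)).map fun j => stdAddChar (N := q) j).sum = 0 := by
    rw [Multiset.map_bind, Multiset.sum_bind]
    simp [sum_map_stdAddChar_rotatedCoset hp hp1]
  constructor
  · induction M using Multiset.strongInductionOn with
    | ih M ih =>
      intro hM
      rcases M.empty_or_exists_mem with rfl | ⟨x, hx⟩
      · exact ⟨0, 0, by simp⟩
      have key {p : ℕ} (hp : p ∣ q) (hp1 : 1 < p) (hle : rotatedCoset q p x ≤ M) :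
          ∃ N rs Rs : Multiset (ZMod q), M = rotatedCoset q p x + N ∧
            N = rs.bind (rotatedCoset q p₁) + Rs.bind (rotatedCoset q p₂) := by
        obtain ⟨N, rfl⟩ := Multiset.le_iff_exists_add.1 hle
        rw [Multiset.map_add, Multiset.sum_add, sum_map_stdAddChar_rotatedCoset hp hp1,
          zero_add] at hM
        have hlt : N < rotatedCoset q p x + N := by
          refine lt_add_of_pos_left N (Multiset.card_pos.1 ?_).bot_lt
          simp [rotatedCoset]
          omega
        obtain ⟨rs, Rs, h⟩ := ih N hlt hM
        exact ⟨N, rs, Rs, rfl, h⟩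
      rcases exists_rotatedCoset_le h₁ h₂ hpr hM hx with hle | hle
      · obtain ⟨N, rs, Rs, hMN, hN⟩ := key h₁ hp₁ hle
        exact ⟨x ::ₘ rs, Rs, by rw [hMN, hN, Multiset.cons_bind, add_assoc]⟩
      · obtain ⟨N, rs, Rs, hMN, hN⟩ := key h₂ hp₂ hle
        exact ⟨rs, x ::ₘ Rs, by rw [hMN, hN, Multiset.cons_bind, add_left_comm]⟩
  · rintro ⟨rs, Rs, rfl⟩
    rw [Multiset.map_add, Multiset.sum_add, hbind h₁ hp₁, hbind h₂ hp₂, add_zero]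

lemma rootSumEval_eq_sum_map {n q : ℕ} [NeZero q] (x : Fin n → ZMod q) :
    rootSumEval n q x =
      ((Multiset.map x Finset.univ.val).map fun j => ZMod.stdAddChar (N := q) j).sum := by
  rw [Multiset.map_map]
  refine Finset.sum_congr rfl fun i _ => ?_
  simpa using (ZMod.stdAddChar_coe (N := q) (x i).val).symm

lemma card_bind_rotatedCoset (q p : ℕ) (s : Multiset (ZMod q)) :
    Multiset.card (s.bind (rotatedCoset q p)) = p * Multiset.card s := by
  simp [Multiset.card_bind, rotatedCoset, mul_comm]

theorem vanishing_sum_two_prime_powers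
    (p₁ p₂ a b q n : ℕ) (hp₁ : p₁.Prime) (hp₂ : p₂.Prime) (hne : p₁ ≠ p₂)
    (ha : 0 < a) (hb : 0 < b) (hq : q = p₁ ^ a * p₂ ^ b) (hn : 0 < n)
    (x : Fin n → ZMod q) :
    rootSumEval n q x = 0 ↔
      (∃ s t : ℕ, p₁ * s + p₂ * t = n ∧
        ∃ rs Rs : Multiset (ZMod q), Multiset.card rs = s ∧ Multiset.card Rs = t ∧
          Multiset.map x Finset.univ.val =
            rs.bind (rotatedCoset q p₁) + Rs.bind (rotatedCoset q p₂)) := by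
  have : NeZero q := ⟨by
    rw [hq]; exact mul_ne_zero (pow_ne_zero _ hp₁.ne_zero) (pow_ne_zero _ hp₂.ne_zero)⟩
  have h₁ : p₁ ∣ q := hq ▸ (dvd_pow_self p₁ ha.ne').mul_right _
  have h₂ : p₂ ∣ q := hq ▸ (dvd_pow_self p₂ hb.ne').mul_left _
  have hpr (p : ℕ) (hp : p.Prime) (hpq : p ∣ q) : p = p₁ ∨ p = p₂ := by
    rw [hq, hp.dvd_mul] at hpq
    exact hpq.imp (fun h => (Nat.prime_dvd_prime_iff_eq hp hp₁).1 (hp.dvd_of_dvd_pow h))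
      fun h => (Nat.prime_dvd_prime_iff_eq hp hp₂).1 (hp.dvd_of_dvd_pow h)
  rw [rootSumEval_eq_sum_map,
    sum_map_stdAddChar_eq_zero_iff h₁ h₂ hp₁.one_lt hp₂.one_lt hpr]
  constructor
  · rintro ⟨rs, Rs, h⟩
    refine ⟨_, _, ?_, rs, Rs, rfl, rfl, h⟩
    rw [← card_bind_rotatedCoset, ← card_bind_rotatedCoset, ← Multiset.card_add, ← h]
    simp
  · rintro ⟨_, _, -, rs, Rs, -, -, h⟩
    exact ⟨rs, Rs, h⟩
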